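/- Fix a prime $q$, and for each prime $p$ define $\varpi(p) = e^{2\pi i/f_q(p)}$ if $p \ne q$ and $\varpi(q) = 0$, where $f_q(p)$ is the multiplicative order of $q$ modulo $p$. Then the series $\sum_{p \text{ prime}} \frac{|1 - \varpi(p)|}{p}$ converges; in particular the sum $\sum_{p \text{ prime}} \frac{1 - \varpi(p)}{p}$ converges absolutely. -/

import Mathlib

open Real Complex

/-- The multiplicative order of `q` modulo `p`, i.e. the order of `q` in `ZMod p`. -/
noncomputable def multOrder (q p : ℕ) : ℕ := orderOf ((q : ZMod p))

/-- The value `ϖ(p) = e^{2πi/f_q(p)}` for primes `p ≠ q`, and `ϖ(q) = 0`. -/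
noncomputable def varpi (q p : ℕ) : ℂ :=
  if p = q then 0 else Complex.exp (2 * (Real.pi : ℂ) * Complex.I / (multOrder q p : ℂ))

lemma two_pow_card_primeFactors_le {n : ℕ} (hn : n ≠ 0) : 2 ^ n.primeFactors.card ≤ n :=
  calc 2 ^ n.primeFactors.card ≤ ∏ p ∈ n.primeFactors, p :=
        Finset.pow_card_le_prod _ _ _ fun _ hp => (Nat.prime_of_mem_primeFactors hp).two_le
    _ ≤ n := Nat.le_of_dvd (Nat.pos_of_ne_zero hn) (Nat.prod_primeFactors_dvd n)

lemma multOrder_self {q : ℕ} (hq : q.Prime) : multOrder q q = 0 := by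
  have := Fact.mk hq
  rw [multOrder, CharP.cast_eq_zero]
  exact orderOf_zero (ZMod q)

lemma natCast_zmod_ne_zero {q p : ℕ} (hq : q.Prime) (hp : p.Prime) (hne : p ≠ q) :
    (q : ZMod p) ≠ 0 := fun h =>
  hne ((Nat.prime_dvd_prime_iff_eq hp hq).1 ((ZMod.natCast_eq_zero_iff q p).1 h))

lemma multOrder_pos {q p : ℕ} (hq : q.Prime) (hp : p.Prime) (hne : p ≠ q) :
    0 < multOrder q p := by
  have : Fact p.Prime := ⟨hp⟩
  exact orderOf_pos_iff.2 (isOfFinOrder_iff_pow_eq_one.2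
    ⟨p - 1, Nat.sub_pos_of_lt hp.one_lt,
      ZMod.pow_card_sub_one_eq_one (natCast_zmod_ne_zero hq hp hne)⟩)

lemma multOrder_dvd_sub_one {q p : ℕ} (hq : q.Prime) (hp : p.Prime) (hne : p ≠ q) :
    multOrder q p ∣ p - 1 := by
  have : Fact p.Prime := ⟨hp⟩
  exact ZMod.orderOf_dvd_card_sub_one (natCast_zmod_ne_zero hq hp hne)

lemma dvd_pow_multOrder_sub_one {q p : ℕ} (hq : q.Prime) :
    p ∣ q ^ multOrder q p - 1 := by
  rw [← ZMod.natCast_eq_zero_iff, Nat.cast_sub (Nat.one_le_pow _ _ hq.pos)]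
  simp [multOrder, pow_orderOf_eq_one]

/-- The primes `p` modulo which `q` has order `f` divide `q ^ f - 1`, so there are at most
`q * f` of them. -/
lemma finite_and_card_multOrder_eq_le {q : ℕ} (hq : q.Prime) {f : ℕ} (hf : 0 < f) :
    Finite {p : {p : ℕ // p.Prime} // multOrder q p = f} ∧
      Nat.card {p : {p : ℕ // p.Prime} // multOrder q p = f} ≤ q * f := by
  have hlt : 1 < q ^ f := Nat.one_lt_pow hf.ne' hq.one_lt
  have hne : q ^ f - 1 ≠ 0 := by omega
  let φ : {p : {p : ℕ // p.Prime} // multOrder q p = f} → (q ^ f - 1).primeFactors := fun p =>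
    ⟨p.1.1, Nat.mem_primeFactors.2 ⟨p.1.2, by
      have := dvd_pow_multOrder_sub_one (p := p.1.1) hq
      rwa [p.2] at this, hne⟩⟩
  have hφ : Function.Injective φ := fun a b h => by
    have hval : (φ a : ℕ) = φ b := congrArg Subtype.val h
    exact Subtype.ext (Subtype.ext hval)
  refine ⟨Finite.of_injective φ hφ, ?_⟩
  have hcard := Nat.card_le_card_of_injective φ hφ
  rw [Nat.card_eq_fintype_card (α := (q ^ f - 1).primeFactors), Fintype.card_coe] at hcard
  refine hcard.trans ((Nat.pow_le_pow_iff_right one_lt_two).1 ?_)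
  calc 2 ^ (q ^ f - 1).primeFactors.card ≤ q ^ f - 1 := two_pow_card_primeFactors_le hne
    _ ≤ q ^ f := Nat.sub_le _ _
    _ ≤ (2 ^ q) ^ f := Nat.pow_le_pow_left Nat.lt_two_pow_self.le f
    _ = 2 ^ (q * f) := (pow_mul _ _ _).symm

lemma summable_multOrder_rpow {q : ℕ} (hq : q.Prime) :
    Summable fun p : {p : ℕ // p.Prime} => (multOrder q p : ℝ) ^ (-(5 / 2) : ℝ) := by
  rw [← (Equiv.sigmaFiberEquiv fun p : {p : ℕ // p.Prime} => multOrder q p).summable_iff]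
  have hval : ((fun p : {p : ℕ // p.Prime} => (multOrder q p : ℝ) ^ (-(5 / 2) : ℝ)) ∘
      (Equiv.sigmaFiberEquiv fun p : {p : ℕ // p.Prime} => multOrder q p)) =
      fun x => (x.1 : ℝ) ^ (-(5 / 2) : ℝ) := by
    ext ⟨f, p, hp⟩
    simp [Equiv.sigmaFiberEquiv, hp]
  rw [hval, summable_sigma_of_nonneg fun _ => by positivity]
  refine ⟨fun f => ?_, ?_⟩
  · rcases Nat.eq_zero_or_pos f with rfl | hf
    · simp
    · have := (finite_and_card_multOrder_eq_le hq hf).1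
      exact Summable.of_finite
  · refine Summable.of_nonneg_of_le (fun f => tsum_nonneg fun _ => by positivity) (fun f => ?_)
      ((Real.summable_nat_rpow.2 (by norm_num : (-(3 / 2) : ℝ) < -1)).mul_left (q : ℝ))
    rcases Nat.eq_zero_or_pos f with rfl | hf
    · simp
    · have hf' : (0 : ℝ) < f := by exact_mod_cast hf
      dsimp only
      rw [tsum_const, nsmul_eq_mul]
      calc _ ≤ ((q * f : ℕ) : ℝ) * (f : ℝ) ^ (-(5 / 2) : ℝ) := by
            gcongr
            exact (finite_and_card_multOrder_eq_le hq hf).2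
        _ = q * (f : ℝ) ^ (-(3 / 2) : ℝ) := by
            rw [show (-(3 / 2) : ℝ) = 1 + -(5 / 2) by norm_num, Real.rpow_add hf', Real.rpow_one]
            push_cast; ring

lemma inv_le_sqrt_div_sq_add_inv_sqrt {x y : ℝ} (hx : 0 < x) (hy : 0 < y) :
    x⁻¹ ≤ √y / x ^ 2 + (√y)⁻¹ := by
  have hs : 0 < √y := Real.sqrt_pos.2 hy
  rcases le_total x √y with h | h
  · have : x⁻¹ ≤ √y / x ^ 2 := by
      rw [le_div_iff₀ (by positivity)]
      field_simp
      exact h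
    linarith [inv_pos.2 hs]
  · have : x⁻¹ ≤ (√y)⁻¹ := inv_anti₀ hs h
    have : 0 ≤ √y / x ^ 2 := by positivity
    linarith

/-- Writing `p = 1 + k * f` with `f` the order of `q` modulo `p`, the pair `(f, k)`
determines `p`. -/
lemma injective_multOrder_prod {q : ℕ} (hq : q.Prime) :
    Function.Injective fun p : {p : ℕ // p.Prime} =>
      ((multOrder q p, ((p : ℕ) - 1) / multOrder q p) : ℕ × ℕ) := by
  intro a b h
  obtain ⟨h₁, h₂⟩ := Prod.mk.inj h
  have key : ∀ p : {p : ℕ // p.Prime}, (p : ℕ) ≠ q →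
      (p : ℕ) - 1 = multOrder q p * (((p : ℕ) - 1) / multOrder q p) := fun p hp =>
    (Nat.mul_div_cancel' (multOrder_dvd_sub_one hq p.2 hp)).symm
  apply Subtype.ext
  by_cases ha : (a : ℕ) = q
  · by_contra hb
    have := multOrder_pos hq b.2 fun hbq => hb (ha.trans hbq.symm)
    rw [← h₁, ha, multOrder_self hq] at this
    exact this.false
  · have hb : (b : ℕ) ≠ q := fun hb => by
      have := multOrder_pos hq a.2 ha
      rw [h₁, hb, multOrder_self hq] at this
      exact this.false
    have ha' := key a ha
    rw [h₂, h₁, ← key b hb] at ha'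
    have := a.2.pos
    have := b.2.pos
    omega

lemma summable_inv_multOrder_mul {q : ℕ} (hq : q.Prime) :
    Summable fun p : {p : ℕ // p.Prime} => ((multOrder q p : ℝ) * (p : ℕ))⁻¹ := by
  have hpair : Summable fun x : ℕ × ℕ => (x.1 : ℝ) ^ (-(3 / 2) : ℝ) * (x.2 : ℝ) ^ (-2 : ℝ) :=
    (Real.summable_nat_rpow.2 (by norm_num)).mul_of_nonneg
      (Real.summable_nat_rpow.2 (by norm_num)) (fun _ => by positivity) (fun _ => by positivity)
  refine Summable.of_nonneg_of_le (fun _ => by positivity) (fun p => ?_)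
    ((hpair.comp_injective (injective_multOrder_prod hq)).add (summable_multOrder_rpow hq))
  simp only [Function.comp_apply]
  by_cases hp : (p : ℕ) = q
  · simp [hp, multOrder_self hq]
  have hf := multOrder_pos hq p.2 hp
  have hmul := Nat.mul_div_cancel' (multOrder_dvd_sub_one hq p.2 hp)
  have hp1 := p.2.one_lt
  generalize ((p : ℕ) - 1) / multOrder q p = k at hmul ⊢
  generalize multOrder q p = f at hf hmul ⊢
  have hk : 0 < k := Nat.pos_of_ne_zero fun h => by
    rw [h] at hmul
    omega
  have hfR : (0 : ℝ) < f := by exact_mod_cast hf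
  have hkR : (0 : ℝ) < k := by exact_mod_cast hk
  have hle : (f : ℝ) * k ≤ (p : ℕ) := by
    exact_mod_cast (by omega : f * k ≤ (p : ℕ))
  have hsplit : ∀ a : ℝ, (f : ℝ) ^ (-2 + a) = ((f : ℝ) ^ 2)⁻¹ * (f : ℝ) ^ a := fun a => by
    rw [Real.rpow_add hfR, Real.rpow_neg hfR.le, Real.rpow_two]
  calc ((f : ℝ) * (p : ℕ))⁻¹ ≤ ((f : ℝ) * (f * k))⁻¹ := by gcongr
    _ = ((f : ℝ) ^ 2)⁻¹ * (k : ℝ)⁻¹ := by rw [← mul_inv]; ring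
    _ ≤ ((f : ℝ) ^ 2)⁻¹ * (√f / (k : ℝ) ^ 2 + (√f)⁻¹) := by
        gcongr
        exact inv_le_sqrt_div_sq_add_inv_sqrt hkR hfR
    _ = (f : ℝ) ^ (-(3 / 2) : ℝ) * (k : ℝ) ^ (-2 : ℝ) + (f : ℝ) ^ (-(5 / 2) : ℝ) := by
        rw [show (-(3 / 2) : ℝ) = -2 + 1 / 2 by norm_num,
          show (-(5 / 2) : ℝ) = -2 + -(1 / 2) by norm_num, hsplit, hsplit,
          Real.rpow_neg hfR.le, ← Real.sqrt_eq_rpow, Real.rpow_neg hkR.le, Real.rpow_two]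
        ring

lemma norm_one_sub_varpi_le {q p : ℕ} (hne : p ≠ q) :
    ‖(1 : ℂ) - varpi q p‖ ≤ 2 * π * (multOrder q p : ℝ)⁻¹ := by
  have h := Real.norm_exp_I_mul_ofReal_sub_one_le (x := 2 * π * (multOrder q p : ℝ)⁻¹)
  rw [Real.norm_of_nonneg (by positivity)] at h
  have harg : 2 * (π : ℂ) * I / (multOrder q p : ℂ) =
      I * ((2 * π * (multOrder q p : ℝ)⁻¹ : ℝ) : ℂ) := by
    push_cast
    ring
  rwa [varpi, if_neg hne, norm_sub_rev, harg]

/-- For a fixed prime `q`, the series `∑_p |1 - ϖ(p)|/p` over all primes `p` converges;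
in particular `∑_p (1 - ϖ(p))/p` converges absolutely. -/
theorem summable_one_sub_varpi (q : ℕ) (hq : q.Prime) :
    Summable (fun p : {p : ℕ // p.Prime} => ‖(1 : ℂ) - varpi q (p : ℕ)‖ / ((p : ℕ) : ℝ)) := by
  refine Summable.of_norm_bounded_eventually
    ((summable_inv_multOrder_mul hq).mul_left (2 * π)) ?_
  filter_upwards [(Set.finite_singleton (⟨q, hq⟩ : {p : ℕ // p.Prime})).compl_mem_cofinite]
    with p hp
  have hne : (p : ℕ) ≠ q := fun h => hp (Subtype.ext h)
  rw [Real.norm_of_nonneg (by positivity), mul_inv, ← mul_assoc, ← div_eq_mul_inv]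
  gcongr
  exact norm_one_sub_varpi_le hne
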